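/- arXiv:1612.08940 — 3 statements merged into one kernel-verified Lean document; each statement's English description precedes it below -/
import Mathlib

section
/- Let B be an n×n complex Hermitian matrix, let ε ∈ {1, −1}, and let k and m be integers with 2 ≤ k and k+1 < m ≤ n. Suppose: ε·det B[α] > 0 for every subset α of size k−1; ε·det B[β] ≥ 0 for every subset β of size k+1, with both a zero and a nonzero principal minor of order k+1 present; and det B[γ] ≠ 0 for every subset γ of size m. Then there exists δ ∈ {1, −1} such that δ·det B[I] > 0 for every subset I of size k. (Equivalently, if ⋯A⁺XS⁺⋯Y⋯ or ⋯A⁻XS⁻⋯Y⋯ with Y ∈ {A*, A⁺, A⁻} is attainable by a Hermitian matrix, then X ∈ {A⁺, A⁻}.) -/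
/-- The principal minor of the complex matrix `B` indexed by the subset `α`
(as a real number; for Hermitian matrices all principal minors are real). -/
noncomputable def pminor {n : ℕ} (B : Matrix (Fin n) (Fin n) ℂ) (α : Finset (Fin n)) : ℝ :=
  (Matrix.det (fun i j : α => B i j)).re

/-- The Schur complement of the principal block `B[α]`, as a matrix on the whole index set. -/
noncomputable def schurCompl {n : ℕ} (B : Matrix (Fin n) (Fin n) ℂ) (α : Finset (Fin n)) :
    Matrix (Fin n) (Fin n) ℂ :=
  B - B.submatrix id ((↑) : α → Fin n) * (B.submatrix ((↑) : α → Fin n) (↑))⁻¹ *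
    B.submatrix ((↑) : α → Fin n) id

theorem schurCompl_isHermitian {n : ℕ} {B : Matrix (Fin n) (Fin n) ℂ} (hB : B.IsHermitian)
    (α : Finset (Fin n)) : (schurCompl B α).IsHermitian := by
  refine hB.sub ?_
  have h : B.submatrix ((↑) : α → Fin n) id = (B.submatrix id ((↑) : α → Fin n)).conjTranspose := by
    rw [Matrix.conjTranspose_submatrix, hB.eq]
  rw [h]
  exact Matrix.isHermitian_mul_mul_conjTranspose _ (hB.submatrix _).inv

/-- Principal minors of a Hermitian matrix are real. -/
theorem ofReal_pminor {n : ℕ} {B : Matrix (Fin n) (Fin n) ℂ} (hB : B.IsHermitian)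
    (α : Finset (Fin n)) :
    (pminor B α : ℂ) = (B.submatrix ((↑) : α → Fin n) (↑)).det := by
  have h : star (B.submatrix ((↑) : α → Fin n) (↑)).det =
      (B.submatrix ((↑) : α → Fin n) (↑)).det := by
    rw [← Matrix.det_conjTranspose, (hB.submatrix _).eq]
  exact Complex.conj_eq_iff_re.mp h

/-- Schur's determinant formula for the principal minor on `α` together with the range of `g`. -/
theorem ofReal_pminor_union {n : ℕ} {B : Matrix (Fin n) (Fin n) ℂ} (hB : B.IsHermitian)
    {α γ : Finset (Fin n)} (hα : pminor B α ≠ 0) {κ : Type*} [Fintype κ] [DecidableEq κ]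
    (g : κ → Fin n) (hg : Function.Injective g)
    (hγ : ∀ x, x ∈ γ ↔ x ∈ α ∨ ∃ t, g t = x) (hdisj : ∀ t, g t ∉ α) :
    (pminor B γ : ℂ) = pminor B α * ((schurCompl B α).submatrix g g).det := by
  have hinj : Function.Injective (Sum.elim ((↑) : α → Fin n) g) :=
    Subtype.val_injective.sumElim hg fun a t h => hdisj t (h ▸ a.2)
  have hmem : ∀ s, Sum.elim ((↑) : α → Fin n) g s ∈ γ := by
    rintro (a | t)
    · exact (hγ _).2 (Or.inl a.2)
    · exact (hγ _).2 (Or.inr ⟨t, rfl⟩)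
  let f : α ⊕ κ → γ := fun s => ⟨Sum.elim (↑) g s, hmem s⟩
  have hf : Function.Bijective f := by
    refine ⟨fun s t h => hinj (congrArg Subtype.val h), ?_⟩
    rintro ⟨x, hx⟩
    rcases (hγ x).1 hx with h | ⟨t, rfl⟩
    · exact ⟨Sum.inl ⟨x, h⟩, rfl⟩
    · exact ⟨Sum.inr t, rfl⟩
  have hunit : IsUnit (B.submatrix ((↑) : α → Fin n) (↑)).det := by
    rw [← ofReal_pminor hB]
    exact isUnit_iff_ne_zero.2 (by exact_mod_cast hα)
  let := Matrix.invertibleOfIsUnitDet _ hunit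
  rw [ofReal_pminor hB, ofReal_pminor hB,
    ← Matrix.det_submatrix_equiv_self (Equiv.ofBijective f hf)]
  have hblocks : (B.submatrix ((↑) : γ → Fin n) (↑)).submatrix
      (Equiv.ofBijective f hf) (Equiv.ofBijective f hf) =
      Matrix.fromBlocks (B.submatrix ((↑) : α → Fin n) (↑)) (B.submatrix (↑) g)
        (B.submatrix g (↑)) (B.submatrix g g) := by
    ext (a | s) (b | t) <;> rfl
  rw [hblocks, Matrix.det_fromBlocks₁₁, Matrix.invOf_eq_nonsing_inv]
  rfl

theorem pminor_insert {n : ℕ} {B : Matrix (Fin n) (Fin n) ℂ} (hB : B.IsHermitian)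
    {α : Finset (Fin n)} (hα : pminor B α ≠ 0) {i : Fin n} (hi : i ∉ α) :
    pminor B (insert i α) = pminor B α * (schurCompl B α i i).re := by
  have h := ofReal_pminor_union hB (γ := insert i α) hα (fun _ : Unit => i)
    (Function.injective_of_subsingleton _) (fun x => by simp [or_comm, eq_comm]) (fun _ => hi)
  simpa using congrArg Complex.re h

theorem pminor_insert_insert {n : ℕ} {B : Matrix (Fin n) (Fin n) ℂ} (hB : B.IsHermitian)
    {α : Finset (Fin n)} (hα : pminor B α ≠ 0) {i j : Fin n} (hi : i ∉ α) (hj : j ∉ α)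
    (hij : i ≠ j) :
    pminor B (insert i (insert j α)) = pminor B α *
      ((schurCompl B α i i).re * (schurCompl B α j j).re - Complex.normSq (schurCompl B α i j)) := by
  have hS := schurCompl_isHermitian hB α
  have h := ofReal_pminor_union hB (γ := insert i (insert j α)) hα ![i, j]
    (by intro s t; fin_cases s <;> fin_cases t <;> simp [hij, hij.symm])
    (fun x => by simp [Fin.exists_fin_two, eq_comm]; tauto)
    (by intro t; fin_cases t <;> simpa)
  rw [Matrix.det_fin_two] at h
  have hji : schurCompl B α j i = star (schurCompl B α i j) := (hS.apply j i).symm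
  have hd : ∀ l, (schurCompl B α l l).im = 0 := fun l =>
    Complex.conj_eq_iff_im.mp (hS.apply l l)
  simpa [hji, hd, Complex.normSq_apply] using congrArg Complex.re h

/-- If the bordering minors of order two above `α` have the sign of the minor at `α`, then so do
the two-by-two minors of the Schur complement. -/
theorem normSq_schurCompl_le {n : ℕ} {B : Matrix (Fin n) (Fin n) ℂ} (hB : B.IsHermitian)
    {ε : ℝ} {α : Finset (Fin n)} (hα : 0 < ε * pminor B α) {i j : Fin n} (hi : i ∉ α)
    (hj : j ∉ α) (hij : i ≠ j) (hβ : 0 ≤ ε * pminor B (insert i (insert j α))) :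
    Complex.normSq (schurCompl B α i j) ≤
      (schurCompl B α i i).re * (schurCompl B α j j).re := by
  rw [pminor_insert_insert hB (right_ne_zero_of_mul hα.ne') hi hj hij, ← mul_assoc] at hβ
  linarith [nonneg_of_mul_nonneg_right hβ hα]

theorem pminor_eq_zero_of_schurCompl_row {n : ℕ} {B : Matrix (Fin n) (Fin n) ℂ}
    (hB : B.IsHermitian) {α γ : Finset (Fin n)} (hα : pminor B α ≠ 0) (hαγ : α ⊆ γ) {i : Fin n}
    (hi : i ∉ α) (hiγ : i ∈ γ) (hrow : ∀ j ∉ α, schurCompl B α i j = 0) : pminor B γ = 0 := by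
  have h := ofReal_pminor_union hB (γ := γ) hα ((↑) : {x // x ∈ γ \ α} → Fin n)
    Subtype.val_injective (fun x => by
      have := @hαγ x
      simp; tauto)
    (fun t => (Finset.mem_sdiff.1 t.2).2)
  rw [Matrix.det_eq_zero_of_row_eq_zero ⟨i, Finset.mem_sdiff.2 ⟨hiγ, hi⟩⟩
    (fun t => hrow _ (Finset.mem_sdiff.1 t.2).2), mul_zero] at h
  exact_mod_cast h

/-- A sign condition that is stable under single exchanges holds for all pairs of sets of the same
cardinality. -/
theorem mul_pos_of_exchange {ι : Type*} [DecidableEq ι] {p : Finset ι → ℝ} {k : ℕ}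
    (hne : ∀ I : Finset ι, I.card = k → p I ≠ 0)
    (hex : ∀ (α : Finset ι) (i j : ι), α.card + 1 = k → i ∉ α → j ∉ α → i ≠ j →
      0 < p (insert i α) * p (insert j α))
    {I J : Finset ι} (hI : I.card = k) (hJ : J.card = k) : 0 < p I * p J := by
  induction hd : (I \ J).card generalizing I with
  | zero =>
    have hsub : I ⊆ J := Finset.sdiff_eq_empty_iff_subset.1 (Finset.card_eq_zero.1 hd)
    rw [Finset.eq_of_subset_of_card_le hsub (by omega)]
    exact mul_self_pos.2 (hne J hJ)
  | succ d ih =>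
    obtain ⟨i, hi⟩ : (I \ J).Nonempty := Finset.card_pos.1 (by omega)
    obtain ⟨j, hj⟩ : (J \ I).Nonempty :=
      Finset.card_pos.1 (by have := Finset.card_sdiff_comm (hI.trans hJ.symm); omega)
    rw [Finset.mem_sdiff] at hi hj
    have hcard : (I.erase i).card + 1 = k := by rw [Finset.card_erase_add_one hi.1, hI]
    have hjα : j ∉ I.erase i := fun h => hj.2 (Finset.mem_of_mem_erase h)
    have hstep := hex (I.erase i) i j hcard (Finset.notMem_erase i I) hjα
      (fun h => hj.2 (h ▸ hi.1))
    rw [Finset.insert_erase hi.1] at hstep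
    have hdiff : insert j (I.erase i) \ J = (I \ J).erase i := by
      rw [Finset.insert_sdiff_of_mem _ hj.1, Finset.erase_sdiff_comm]
    have hrest := ih (I := insert j (I.erase i)) (by rw [Finset.card_insert_of_notMem hjα, hcard])
      (by rw [hdiff, Finset.card_erase_of_mem (Finset.mem_sdiff.2 hi), hd]; rfl)
    have := mul_pos hstep hrest
    nlinarith [sq_nonneg (p (insert j (I.erase i))),
      pos_of_mul_pos_left (b := p (insert j (I.erase i)) ^ 2) (a := p I * p J)
        (by linarith) (sq_nonneg _)]


/-- if ⋯A⁺XS⁺⋯Y⋯ or ⋯A⁻XS⁻⋯Y⋯ with Y ∈ {A*, A⁺, A⁻} is attainable by a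
Hermitian matrix, then X ∈ {A⁺, A⁻}. -/
theorem AXS_dots_A {n : ℕ} (B : Matrix (Fin n) (Fin n) ℂ) (hB : B.IsHermitian)
    (ε : ℝ) (hε : ε = 1 ∨ ε = -1) (k m : ℕ) (hk : 2 ≤ k) (hm1 : k + 1 < m) (hm2 : m ≤ n)
    (h1 : ∀ α : Finset (Fin n), α.card = k - 1 → 0 < ε * pminor B α)
    (h2 : ∀ β : Finset (Fin n), β.card = k + 1 → 0 ≤ ε * pminor B β)
    (h2zero : ∃ β : Finset (Fin n), β.card = k + 1 ∧ pminor B β = 0)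
    (h2nonzero : ∃ β : Finset (Fin n), β.card = k + 1 ∧ pminor B β ≠ 0)
    (h3 : ∀ γ : Finset (Fin n), γ.card = m → pminor B γ ≠ 0) :
    ∃ δ : ℝ, (δ = 1 ∨ δ = -1) ∧
      ∀ I : Finset (Fin n), I.card = k → 0 < δ * pminor B I := by
  have hα0 : ∀ α : Finset (Fin n), α.card + 1 = k → pminor B α ≠ 0 := fun α hα =>
    right_ne_zero_of_mul (h1 α (by omega)).ne'
  have hle : ∀ (α : Finset (Fin n)) (i j : Fin n), α.card + 1 = k → i ∉ α → j ∉ α → i ≠ j →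
      Complex.normSq (schurCompl B α i j) ≤
        (schurCompl B α i i).re * (schurCompl B α j j).re := fun α i j hα hi hj hij =>
    normSq_schurCompl_le hB (h1 α (by omega)) hi hj hij <| h2 _ <| by
      have hi' : i ∉ insert j α := by simp [hij, hi]
      rw [Finset.card_insert_of_notMem hi', Finset.card_insert_of_notMem hj, hα]
  have hne : ∀ I : Finset (Fin n), I.card = k → pminor B I ≠ 0 := by
    intro I hI hzero
    obtain ⟨i, hiI⟩ : I.Nonempty := Finset.card_pos.1 (by omega)
    have hα : (I.erase i).card + 1 = k := by rw [Finset.card_erase_add_one hiI, hI]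
    have hi : i ∉ I.erase i := Finset.notMem_erase i I
    rw [← Finset.insert_erase hiI, pminor_insert hB (hα0 _ hα) hi] at hzero
    have hii := (mul_eq_zero.1 hzero).resolve_left (hα0 _ hα)
    obtain ⟨γ, hIγ, hγ⟩ := Finset.exists_superset_card_eq (s := I) (n := m) (by omega) (by simpa)
    refine h3 γ hγ (pminor_eq_zero_of_schurCompl_row hB (hα0 _ hα)
      ((Finset.erase_subset i I).trans hIγ) hi (hIγ hiI) fun j hj => ?_)
    by_cases hij : i = j
    · subst hij
      exact Complex.ext hii (Complex.conj_eq_iff_im.mp ((schurCompl_isHermitian hB _).apply i i))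
    · have h := hle _ i j hα hi hj hij
      rw [hii, zero_mul] at h
      exact Complex.normSq_eq_zero.1 (le_antisymm h (Complex.normSq_nonneg _))
  have hpos : ∀ I J : Finset (Fin n), I.card = k → J.card = k → 0 < pminor B I * pminor B J := by
    refine fun I J => mul_pos_of_exchange hne fun α i j hα hi hj hij => ?_
    refine lt_of_le_of_ne ?_ (Ne.symm (mul_ne_zero
      (hne _ (by rw [Finset.card_insert_of_notMem hi, hα]))
      (hne _ (by rw [Finset.card_insert_of_notMem hj, hα]))))
    rw [pminor_insert hB (hα0 α hα) hi, pminor_insert hB (hα0 α hα) hj, mul_mul_mul_comm]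
    exact mul_nonneg (mul_self_nonneg _)
      ((Complex.normSq_nonneg _).trans (hle α i j hα hi hj hij))
  obtain ⟨J, -, hJ⟩ := Finset.exists_subset_card_eq
    (s := (Finset.univ : Finset (Fin n))) (n := k) (by simp; omega)
  rcases (hne J hJ).lt_or_gt with h | h
  · refine ⟨-1, Or.inr rfl, fun I hI => ?_⟩
    nlinarith [neg_of_mul_pos_left (hpos I J hI hJ) h.le]
  · refine ⟨1, Or.inl rfl, fun I hI => ?_⟩
    rw [one_mul]
    exact pos_of_mul_pos_left (hpos I J hI hJ) h.le
end

section
/- Let B be an n×n complex Hermitian matrix and let k be an integer with 1 ≤ k ≤ n−2. Suppose: B has both a zero and a nonzero principal minor of order k; every principal minor of order k+1 is zero; and B has both a zero and a nonzero principal minor of order k+2. Then one of the following holds: (a) B has both a positive and a negative principal minor of order k, and both a positive and a negative principal minor of order k+2; (b) every nonzero principal minor of order k is positive and every nonzero principal minor of order k+2 is negative; (c) every nonzero principal minor of order k is negative and every nonzero principal minor of order k+2 is positive. (If the epr-sequence contains SNS at positions k, k+1, k+2, then the sepr-sequence there is S*NS*, S⁺NS⁻, or S⁻NS⁺.) -/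
open Matrix in
/-- Jacobi's identity for principal minors of the inverse matrix. -/
theorem det_inv_submatrix_mul_det {β ι κ : Type*} [Fintype β] [DecidableEq β] [Fintype ι]
    [DecidableEq ι] [Fintype κ] [DecidableEq κ] (M : Matrix β β ℂ) (hM : M.det ≠ 0)
    (e : ι ⊕ κ ≃ β) :
    (M⁻¹.submatrix (e ∘ Sum.inl) (e ∘ Sum.inl)).det * M.det =
      (M.submatrix (e ∘ Sum.inr) (e ∘ Sum.inr)).det := by
  have hM' : IsUnit M.det := isUnit_iff_ne_zero.mpr hM
  set K := M.submatrix e e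
  have hK : K = fromBlocks K.toBlocks₁₁ K.toBlocks₁₂ K.toBlocks₂₁ K.toBlocks₂₂ :=
    (fromBlocks_toBlocks K).symm
  set N := M⁻¹.submatrix e e
  have hN : N = fromBlocks N.toBlocks₁₁ N.toBlocks₁₂ N.toBlocks₂₁ N.toBlocks₂₂ :=
    (fromBlocks_toBlocks N).symm
  have hKN : K * N = 1 := by
    simp only [K, N, submatrix_mul_equiv, mul_nonsing_inv M hM', submatrix_one_equiv]
  rw [hK, hN, fromBlocks_multiply, ← fromBlocks_one, fromBlocks_inj] at hKN
  have hprod : K * fromBlocks N.toBlocks₁₁ 0 N.toBlocks₂₁ 1 =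
      fromBlocks 1 K.toBlocks₁₂ 0 K.toBlocks₂₂ := by
    conv_lhs => rw [hK]
    rw [fromBlocks_multiply, hKN.1, hKN.2.2.1]
    simp
  have hdet := congrArg det hprod
  rw [det_mul, det_fromBlocks_zero₁₂, det_fromBlocks_zero₂₁, det_one, det_one, mul_one, one_mul,
    det_submatrix_equiv_self, mul_comm] at hdet
  exact hdet

open Matrix in
/-- Schur's determinant formula for a principal minor extending an invertible one. -/
theorem det_submatrix_sumElim {m ι κ : Type*} [Fintype ι] [DecidableEq ι]
    [Fintype κ] [DecidableEq κ] (B : Matrix m m ℂ) (f : ι → m) (g : κ → m)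
    (hA : (B.submatrix f f).det ≠ 0) :
    (B.submatrix (Sum.elim f g) (Sum.elim f g)).det =
      (B.submatrix f f).det *
        ((B - B.submatrix id f * (B.submatrix f f)⁻¹ * B.submatrix f id).submatrix g g).det := by
  let := invertibleOfIsUnitDet (B.submatrix f f) (isUnit_iff_ne_zero.mpr hA)
  have h : B.submatrix (Sum.elim f g) (Sum.elim f g) =
      fromBlocks (B.submatrix f f) (B.submatrix f g) (B.submatrix g f) (B.submatrix g g) := by
    ext (i | i) (j | j) <;> rfl
  rw [h, det_fromBlocks₁₁, invOf_eq_nonsing_inv]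
  rfl

open Matrix in
theorem Matrix.IsHermitian.det_fin_two_of_diag_eq_zero {m : Type*} {C : Matrix m m ℂ}
    (hC : C.IsHermitian) (hdiag : ∀ i, C i i = 0) (i j : m) :
    (C.submatrix ![i, j] ![i, j]).det = ((-Complex.normSq (C i j) : ℝ) : ℂ) := by
  have h : C j i = (starRingEnd ℂ) (C i j) := (hC.apply j i).symm
  rw [det_fin_two]
  simp [hdiag, h, Complex.mul_conj]

theorem pminor_image {n : ℕ} {ι : Type*} [Fintype ι] [DecidableEq ι]
    (B : Matrix (Fin n) (Fin n) ℂ) (f : ι → Fin n) (hf : f.Injective) :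
    pminor B (Finset.univ.image f) = (B.submatrix f f).det.re := by
  have hbij : Function.Bijective
      (fun i => ⟨f i, Finset.mem_image_of_mem f (Finset.mem_univ i)⟩ :
        ι → (Finset.univ.image f : Finset (Fin n))) := by
    refine ⟨fun i j h => hf (congrArg Subtype.val h), ?_⟩
    rintro ⟨x, hx⟩
    obtain ⟨i, -, rfl⟩ := Finset.mem_image.mp hx
    exact ⟨i, rfl⟩
  exact congrArg Complex.re
    (Matrix.det_submatrix_equiv_self (Equiv.ofBijective _ hbij) (B.submatrix _ _)).symm

theorem injective_of_det_submatrix_ne_zero {m ι : Type*} [Fintype ι] [DecidableEq ι]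
    (B : Matrix m m ℂ) (f : ι → m) (h : (B.submatrix f f).det ≠ 0) : f.Injective := by
  intro i j hij
  by_contra hne
  exact h (Matrix.det_zero_of_row_eq hne (by ext l; simp [hij]))

theorem Matrix.IsHermitian.ofReal_re_det {ι : Type*} [Fintype ι] [DecidableEq ι]
    {M : Matrix ι ι ℂ} (hM : M.IsHermitian) : ((M.det.re : ℝ) : ℂ) = M.det := by
  apply Complex.conj_eq_iff_re.mp
  have h := Matrix.det_conjTranspose M
  rw [hM.eq] at h
  exact h.symm

theorem det_submatrix_eq_zero_of_pminor {n k : ℕ} {B : Matrix (Fin n) (Fin n) ℂ}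
    (hB : B.IsHermitian) (hN : ∀ α : Finset (Fin n), α.card = k → pminor B α = 0)
    {ι : Type*} [Fintype ι] [DecidableEq ι] (f : ι → Fin n) (hι : Fintype.card ι = k) :
    (B.submatrix f f).det = 0 := by
  by_contra h
  have hf := injective_of_det_submatrix_ne_zero B f h
  apply h
  rw [← (hB.submatrix f).ofReal_re_det, ← pminor_image B f hf,
    hN _ (by rw [Finset.card_image_of_injective _ hf, Finset.card_univ, hι]), Complex.ofReal_zero]

open Matrix in
/-- If all principal minors of order `k + 1` vanish, a nonzero one of order `k + 2` contains
one of order `k` of the opposite sign. -/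
theorem exists_pminor_mul_neg_of_card_add_two {n k : ℕ} {B : Matrix (Fin n) (Fin n) ℂ}
    (hB : B.IsHermitian) (hN : ∀ α : Finset (Fin n), α.card = k + 1 → pminor B α = 0)
    (β : Finset (Fin n)) (hβ : β.card = k + 2) (h : pminor B β ≠ 0) :
    ∃ α : Finset (Fin n), α.card = k ∧ pminor B α * pminor B β < 0 := by
  set M : Matrix β β ℂ := B.submatrix Subtype.val Subtype.val with hMdef
  have hMβ : M.det.re = pminor B β := rfl
  have hMh : M.IsHermitian := hB.submatrix _
  have hM : M.det = (pminor B β : ℂ) := by rw [← hMβ, hMh.ofReal_re_det]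
  have hM0 : M.det ≠ 0 := by rw [hM]; exact_mod_cast h
  have hcard : Fintype.card β = k + 2 := by simp [hβ]
  have key : ∀ (r : ℕ) (g : Fin r → β) (hg : g.Injective),
      ∃ f : {x // x ∉ Set.range g} → Fin n, f.Injective ∧
        Fintype.card {x // x ∉ Set.range g} + r = k + 2 ∧
        (M⁻¹.submatrix g g).det * M.det = (B.submatrix f f).det := by
    intro r g hg
    let e : Fin r ⊕ {x // x ∉ Set.range g} ≃ β :=
      (Equiv.sumCongr (Equiv.ofInjective g hg) (Equiv.refl _)).trans
        (Equiv.Set.sumCompl (Set.range g))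
    refine ⟨fun x => (x.1 : Fin n), Subtype.val_injective.comp Subtype.val_injective, ?_, ?_⟩
    · have := Fintype.card_congr e
      rw [Fintype.card_sum, Fintype.card_fin, hcard] at this
      omega
    · exact det_inv_submatrix_mul_det M hM0 e
  have hdiag : ∀ i, M⁻¹ i i = 0 := by
    intro i
    obtain ⟨f, -, hc, hd⟩ := key 1 ![i] (Function.injective_of_subsingleton _)
    rw [det_submatrix_eq_zero_of_pminor hB hN f (by omega), det_fin_one] at hd
    exact (mul_eq_zero.mp hd).resolve_right hM0
  obtain ⟨i, j, hij⟩ : ∃ i j, M⁻¹ i j ≠ 0 := by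
    by_contra! hzero
    have h0 : M⁻¹ = 0 := by ext i j; exact hzero i j
    have h1 := mul_nonsing_inv M (isUnit_iff_ne_zero.mpr hM0)
    rw [h0, mul_zero] at h1
    have hne : Nonempty β := Fintype.card_pos_iff.mp (by omega)
    exact zero_ne_one h1
  have hne : i ≠ j := fun hij' => hij (by rw [hij']; exact hdiag j)
  obtain ⟨f, hf, hc, hd⟩ := key 2 ![i, j] (by
    intro a b; fin_cases a <;> fin_cases b <;> simp [hne, hne.symm])
  refine ⟨Finset.univ.image f, ?_, ?_⟩
  · rw [Finset.card_image_of_injective _ hf, Finset.card_univ]; omega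
  · rw [hMh.inv.det_fin_two_of_diag_eq_zero hdiag, hM, ← Complex.ofReal_mul] at hd
    rw [pminor_image B f hf, ← hd, Complex.ofReal_re]
    have h1 := Complex.normSq_pos.mpr hij
    have h2 := mul_pos h1 (mul_self_pos.mpr h)
    linarith

open Matrix in
/-- If all principal minors of order `k + 1` vanish and some minor of order `k + 2` does not,
a nonzero principal minor of order `k` extends to one of order `k + 2` of the opposite sign. -/
theorem exists_pminor_mul_neg_of_card {n k : ℕ} {B : Matrix (Fin n) (Fin n) ℂ}
    (hB : B.IsHermitian) (hN : ∀ α : Finset (Fin n), α.card = k + 1 → pminor B α = 0)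
    (hne : ∃ β : Finset (Fin n), β.card = k + 2 ∧ pminor B β ≠ 0)
    (α : Finset (Fin n)) (hα : α.card = k) (h : pminor B α ≠ 0) :
    ∃ β : Finset (Fin n), β.card = k + 2 ∧ pminor B α * pminor B β < 0 := by
  set v : α → Fin n := Subtype.val
  have hAh : (B.submatrix v v).IsHermitian := hB.submatrix v
  have hA : (B.submatrix v v).det = (pminor B α : ℂ) := hAh.ofReal_re_det.symm
  have hA0 : (B.submatrix v v).det ≠ 0 := by rw [hA]; exact_mod_cast h
  set S := B.submatrix id v * (B.submatrix v v)⁻¹ * B.submatrix v id with hS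
  have hdet (r : ℕ) (g : Fin r → Fin n) :=
    det_submatrix_sumElim B v g hA0
  have hCh : (B - S).IsHermitian := by
    refine hB.sub ?_
    rw [IsHermitian, hS, conjTranspose_mul, conjTranspose_mul, conjTranspose_submatrix,
      conjTranspose_submatrix, hB.eq, hAh.inv.eq, Matrix.mul_assoc]
  have hdiag : ∀ i, (B - S) i i = 0 := by
    intro i
    have := hdet 1 ![i]
    rw [det_submatrix_eq_zero_of_pminor hB hN _ (by simp [hα]), det_fin_one] at this
    exact (mul_eq_zero.mp this.symm).resolve_left hA0
  obtain ⟨i, j, hij⟩ : ∃ i j, (B - S) i j ≠ 0 := by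
    by_contra! hzero
    have hBS : B = S := by
      ext i j
      exact sub_eq_zero.mp (hzero i j)
    obtain ⟨β, hβ, hβ0⟩ := hne
    set w : β → Fin n := Subtype.val
    have hw : (B.submatrix w w).det ≠ 0 := fun h0 => hβ0 (by
      change (B.submatrix w w).det.re = 0
      rw [h0, Complex.zero_re])
    have h1 := rank_of_isUnit _
      ((isUnit_iff_isUnit_det _).mpr (isUnit_iff_ne_zero.mpr hw))
    have h2 : B.submatrix w w =
        (B.submatrix w v * (B.submatrix v v)⁻¹) * B.submatrix v w := by
      conv_lhs => rw [hBS]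
      rfl
    have h3 := (rank_mul_le_right (B.submatrix w v * (B.submatrix v v)⁻¹)
      (B.submatrix v w)).trans (rank_le_card_height _)
    rw [← h2, h1] at h3
    simp only [Fintype.card_coe, hα, hβ] at h3
    omega
  have h2 := hdet 2 ![i, j]
  rw [hCh.det_fin_two_of_diag_eq_zero hdiag, hA, ← Complex.ofReal_mul] at h2
  have h1 := Complex.normSq_pos.mpr hij
  have hf := injective_of_det_submatrix_ne_zero B (Sum.elim v ![i, j]) (by
    rw [h2]
    exact_mod_cast mul_ne_zero h (neg_ne_zero.mpr h1.ne'))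
  refine ⟨Finset.univ.image (Sum.elim v ![i, j]), ?_, ?_⟩
  · rw [Finset.card_image_of_injective _ hf, Finset.card_univ]; simp [hα]
  · rw [pminor_image B _ hf, h2, Complex.ofReal_re]
    have h3 := mul_pos h1 (mul_self_pos.mpr h)
    linarith

/-- if the epr-sequence of a Hermitian matrix contains SNS at positions
k, k+1, k+2, then the sepr-sequence there is S*NS*, S⁺NS⁻, or S⁻NS⁺. -/
theorem SNS_signs {n : ℕ} (B : Matrix (Fin n) (Fin n) ℂ) (hB : B.IsHermitian)
    (k : ℕ) (hk1 : 1 ≤ k) (hk2 : k ≤ n - 2)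
    (hkzero : ∃ α : Finset (Fin n), α.card = k ∧ pminor B α = 0)
    (hknonzero : ∃ α : Finset (Fin n), α.card = k ∧ pminor B α ≠ 0)
    (hN : ∀ α : Finset (Fin n), α.card = k + 1 → pminor B α = 0)
    (hk2zero : ∃ β : Finset (Fin n), β.card = k + 2 ∧ pminor B β = 0)
    (hk2nonzero : ∃ β : Finset (Fin n), β.card = k + 2 ∧ pminor B β ≠ 0) :
    (((∃ α : Finset (Fin n), α.card = k ∧ 0 < pminor B α) ∧
      (∃ α : Finset (Fin n), α.card = k ∧ pminor B α < 0) ∧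
      (∃ β : Finset (Fin n), β.card = k + 2 ∧ 0 < pminor B β) ∧
      (∃ β : Finset (Fin n), β.card = k + 2 ∧ pminor B β < 0)) ∨
     ((∀ α : Finset (Fin n), α.card = k → pminor B α ≠ 0 → 0 < pminor B α) ∧
      (∀ β : Finset (Fin n), β.card = k + 2 → pminor B β ≠ 0 → pminor B β < 0)) ∨
     ((∀ α : Finset (Fin n), α.card = k → pminor B α ≠ 0 → pminor B α < 0) ∧
      (∀ β : Finset (Fin n), β.card = k + 2 → pminor B β ≠ 0 → 0 < pminor B β))) := by
  have up := exists_pminor_mul_neg_of_card hB hN hk2nonzero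
  have down := exists_pminor_mul_neg_of_card_add_two hB hN
  have upPos : ∀ α : Finset (Fin n), α.card = k → 0 < pminor B α →
      ∃ β : Finset (Fin n), β.card = k + 2 ∧ pminor B β < 0 := fun α hα h =>
    let ⟨β, hβ, hs⟩ := up α hα h.ne'
    ⟨β, hβ, neg_of_mul_neg_right hs h.le⟩
  have upNeg : ∀ α : Finset (Fin n), α.card = k → pminor B α < 0 →
      ∃ β : Finset (Fin n), β.card = k + 2 ∧ 0 < pminor B β := fun α hα h =>
    let ⟨β, hβ, hs⟩ := up α hα h.ne
    ⟨β, hβ, pos_of_mul_neg_right hs h.le⟩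
  have downPos : ∀ β : Finset (Fin n), β.card = k + 2 → 0 < pminor B β →
      ∃ α : Finset (Fin n), α.card = k ∧ pminor B α < 0 := fun β hβ h =>
    let ⟨α, hα, hs⟩ := down β hβ h.ne'
    ⟨α, hα, neg_of_mul_neg_left hs h.le⟩
  have downNeg : ∀ β : Finset (Fin n), β.card = k + 2 → pminor B β < 0 →
      ∃ α : Finset (Fin n), α.card = k ∧ 0 < pminor B α := fun β hβ h =>
    let ⟨α, hα, hs⟩ := down β hβ h.ne
    ⟨α, hα, pos_of_mul_neg_left hs h.le⟩
  by_cases hp : ∃ α : Finset (Fin n), α.card = k ∧ 0 < pminor B α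
  · by_cases hm : ∃ α : Finset (Fin n), α.card = k ∧ pminor B α < 0
    · obtain ⟨α, hα, h⟩ := hp
      obtain ⟨α', hα', h'⟩ := hm
      exact Or.inl ⟨⟨α, hα, h⟩, ⟨α', hα', h'⟩, upNeg α' hα' h', upPos α hα h⟩
    · refine Or.inr (Or.inl ⟨fun α hα h => ?_, fun β hβ h => ?_⟩)
      · exact h.lt_or_gt.resolve_left fun h' => hm ⟨α, hα, h'⟩
      · exact h.lt_or_gt.resolve_right fun h' => hm (downPos β hβ h')
  · refine Or.inr (Or.inr ⟨fun α hα h => ?_, fun β hβ h => ?_⟩)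
    · exact h.lt_or_gt.resolve_right fun h' => hp ⟨α, hα, h'⟩
    · exact h.lt_or_gt.resolve_left fun h' => hp (downNeg β hβ h')
end

section
/- Let B be an n×n real symmetric matrix and let k be an integer with 2 ≤ k ≤ n−2. Suppose every principal minor of B of order k−1 is nonzero, every principal minor of order k is zero, and every principal minor of order k+1 is nonzero. Then for every i with 1 ≤ i ≤ n and i ≠ k, there exists δ_i ∈ {1, −1} such that δ_i · det B[α] > 0 for every subset α of size i; moreover δ_{k+1} = −δ_{k−1}. -/
/-- The principal minor of the real matrix `B` indexed by the subset `α`. -/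
noncomputable def pminorR {n : ℕ} (B : Matrix (Fin n) (Fin n) ℝ) (α : Finset (Fin n)) : ℝ :=
  Matrix.det (fun i j : α => B i j)

open Matrix Finset Function

/-- `B` is, up to a nonzero factor, diagonally congruent to `c • 1 - J`, where `J` is the all-ones
matrix. -/
def IsScaledShift {ι : Type*} [DecidableEq ι] (c : ℝ) (B : Matrix ι ι ℝ) : Prop :=
  ∃ (a : ℝ) (d : ι → ℝ), a ≠ 0 ∧ (∀ i, d i ≠ 0) ∧
    ∀ i j, B i j = a * d i * d j * ((if i = j then c else 0) - 1)

lemma det_submatrix_of_injective {n : ℕ} (B : Matrix (Fin n) (Fin n) ℝ) {m : Type*} [Fintype m]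
    [DecidableEq m] (f : m → Fin n) (hf : Injective f) :
    (B.submatrix f f).det = pminorR B (univ.map ⟨f, hf⟩) := by
  let e : m ≃ (univ.map ⟨f, hf⟩ : Finset (Fin n)) :=
    Equiv.ofBijective (fun x => ⟨f x, by simp⟩)
      ⟨fun x y h => hf (congrArg Subtype.val h), fun ⟨y, hy⟩ => by
        obtain ⟨x, -, rfl⟩ := Finset.mem_map.1 hy
        exact ⟨x, rfl⟩⟩
  exact det_submatrix_equiv_self e (fun i j : (univ.map ⟨f, hf⟩ : Finset (Fin n)) => B i j)

/-- A symmetric matrix with nonsingular leading block is nonsingular if all minors of order one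
beyond the block vanish and all minors of order two beyond the block do not. -/
lemma det_ne_zero_of_bordered {m : Type*} [Fintype m] [DecidableEq m]
    (M : Matrix (m ⊕ Fin 3) (m ⊕ Fin 3) ℝ) (hM : M.IsSymm) (hA : M.toBlocks₁₁.det ≠ 0)
    (hzero : ∀ f : Fin 1 → Fin 3, (M.submatrix (Sum.map id f) (Sum.map id f)).det = 0)
    (hne : ∀ f : Fin 2 → Fin 3, Injective f →
      (M.submatrix (Sum.map id f) (Sum.map id f)).det ≠ 0) :
    M.det ≠ 0 := by
  have : Invertible M.toBlocks₁₁ := invertibleOfIsUnitDet _ hA.isUnit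
  set C := M.toBlocks₂₂ - M.toBlocks₂₁ * ⅟M.toBlocks₁₁ * M.toBlocks₁₂ with hC
  have key {t : ℕ} (f : Fin t → Fin 3) : (M.submatrix (Sum.map id f) (Sum.map id f)).det =
      M.toBlocks₁₁.det * (C.submatrix f f).det := by
    have h : M.submatrix (Sum.map id f) (Sum.map id f) = fromBlocks M.toBlocks₁₁
        (M.toBlocks₁₂.submatrix id f) (M.toBlocks₂₁.submatrix f id)
        (M.toBlocks₂₂.submatrix f f) := by
      ext (i | i) (j | j) <;> rfl
    rw [h, det_fromBlocks₁₁]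
    rfl
  have hCs : C.IsSymm := by
    have h12 : M.toBlocks₁₂ᵀ = M.toBlocks₂₁ := by ext i j; exact hM.apply _ _
    have h21 : M.toBlocks₂₁ᵀ = M.toBlocks₁₂ := by ext i j; exact hM.apply _ _
    have h11 : M.toBlocks₁₁ᵀ = M.toBlocks₁₁ := by ext i j; exact hM.apply _ _
    have h22 : M.toBlocks₂₂ᵀ = M.toBlocks₂₂ := by ext i j; exact hM.apply _ _
    rw [Matrix.IsSymm, hC, transpose_sub, transpose_mul, transpose_mul, invOf_eq_nonsing_inv,
      transpose_nonsing_inv, h12, h21, h11, h22, Matrix.mul_assoc]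
  have hdiag (i : Fin 3) : C i i = 0 := by
    have h := hzero fun _ => i
    rw [key] at h
    simpa [hA] using h
  have hoff (i j : Fin 3) (hij : i ≠ j) : C i j ≠ 0 := by
    have h := hne ![i, j] (by
      intro x y; fin_cases x <;> fin_cases y <;> simp [hij, hij.symm])
    rw [key, det_fin_two] at h
    intro h0
    simp [hdiag, h0] at h
  have hdet := key (id : Fin 3 → Fin 3)
  rw [Sum.map_id_id, submatrix_id_id, submatrix_id_id, det_fin_three] at hdet
  rw [hdet]
  refine mul_ne_zero hA ?_
  have h : C 0 0 * C 1 1 * C 2 2 - C 0 0 * C 1 2 * C 2 1 - C 0 1 * C 1 0 * C 2 2 +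
      C 0 1 * C 1 2 * C 2 0 + C 0 2 * C 1 0 * C 2 1 - C 0 2 * C 1 1 * C 2 0 =
      2 * (C 0 1 * C 1 2 * C 0 2) := by
    rw [hdiag 0, hdiag 1, hdiag 2, hCs.apply 0 1, hCs.apply 0 2, hCs.apply 1 2]
    ring
  rw [h]
  have h01 := hoff 0 1 (by decide)
  have h12 := hoff 1 2 (by decide)
  have h02 := hoff 0 2 (by decide)
  positivity

lemma det_mul_det_toBlocks₁₁_of_mul_eq_one {p q : Type*} [Fintype p] [Fintype q] [DecidableEq p]
    [DecidableEq q] (M N : Matrix (p ⊕ q) (p ⊕ q) ℝ) (h : M * N = 1) :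
    M.det * N.toBlocks₁₁.det = M.toBlocks₂₂.det := by
  have hblock := h
  rw [← fromBlocks_toBlocks M, ← fromBlocks_toBlocks N, fromBlocks_multiply, ← fromBlocks_one,
    fromBlocks_inj] at hblock
  have hmul : M * fromBlocks N.toBlocks₁₁ 0 N.toBlocks₂₁ 1 =
      fromBlocks 1 M.toBlocks₁₂ 0 M.toBlocks₂₂ := by
    conv_lhs => rw [← fromBlocks_toBlocks M]
    rw [fromBlocks_multiply, hblock.1, hblock.2.2.1]
    simp
  have hdet := congrArg det hmul
  rwa [det_mul, det_fromBlocks_zero₁₂, det_fromBlocks_zero₂₁, det_one, det_one, mul_one,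
    one_mul] at hdet

/-- The Jacobi identity for complementary principal minors of an inverse matrix. -/
lemma det_mul_det_submatrix_of_mul_eq_one {ι p : Type*} [Fintype ι] [DecidableEq ι] [Fintype p]
    [DecidableEq p] (M N : Matrix ι ι ℝ) (h : M * N = 1) (f : p → ι) (hf : Injective f) :
    ∃ (s : Finset ι), s.card + Fintype.card p = Fintype.card ι ∧
      M.det * (N.submatrix f f).det = (M.submatrix ((↑) : s → ι) (↑)).det := by
  classical
  let s : Finset ι := (univ.map ⟨f, hf⟩)ᶜ
  have hs : s.card + Fintype.card p = Fintype.card ι := by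
    have h1 := card_compl_add_card (univ.map ⟨f, hf⟩)
    rwa [card_map, card_univ] at h1
  have hbij : Bijective (Sum.elim f ((↑) : s → ι)) := by
    rw [Fintype.bijective_iff_injective_and_card]
    refine ⟨hf.sumElim Subtype.val_injective fun x y hxy => ?_, ?_⟩
    · have hy := y.2
      rw [← hxy] at hy
      simp [s] at hy
    · rw [Fintype.card_sum, Fintype.card_coe, add_comm, hs]
  let e := Equiv.ofBijective _ hbij
  refine ⟨s, hs, ?_⟩
  have hmul : M.submatrix e e * N.submatrix e e = 1 := by
    rw [submatrix_mul_equiv, h, submatrix_one_equiv]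
  have hj := det_mul_det_toBlocks₁₁_of_mul_eq_one _ _ hmul
  rwa [det_submatrix_equiv_self] at hj

lemma IsScaledShift.of_relations {ι : Type*} [DecidableEq ι] {c : ℝ} (hc : c ≠ 1)
    {B : Matrix ι ι ℝ} (hB : B.IsSymm) (o : ι) (ho : B o o ≠ 0) (hne : ∀ i, i ≠ o → B o i ≠ 0)
    (hdiag : ∀ i, i ≠ o → B o o * B i i = (c - 1) ^ 2 * B o i ^ 2)
    (hoff : ∀ i j, i ≠ o → j ≠ o → i ≠ j → B o o * B i j = -(c - 1) * B o i * B o j) :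
    IsScaledShift c B := by
  have hc' : c - 1 ≠ 0 := sub_ne_zero.2 hc
  refine ⟨(c - 1) / B o o, fun i => if i = o then -B o o / (c - 1) else B o i,
    div_ne_zero hc' ho, fun i => ?_, fun i j => ?_⟩
  · dsimp only
    split_ifs with h
    · exact div_ne_zero (neg_ne_zero.2 ho) hc'
    · exact hne i h
  · by_cases hi : i = o <;> by_cases hj : j = o
    · subst hi hj
      simp
      field_simp
    · subst hi
      simp [hj, Ne.symm hj]
      field_simp
    · subst hj
      rw [← hB.apply]
      simp [hi]
      field_simp
    · by_cases hij : i = j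
      · subst hij
        simp [hi]
        field_simp
        linear_combination hdiag i hi
      · simp [hi, hj, hij]
        field_simp
        linear_combination hoff i j hi hj hij

/-- Nonzero entries on the diagonal, vanishing minors of order two and nonzero minors of order
three force the shape `2 • 1 - J`. -/
lemma IsScaledShift.of_minors_two {ι : Type*} [DecidableEq ι] {N : Matrix ι ι ℝ} (hN : N.IsSymm)
    (o : ι) (h1 : ∀ i, N i i ≠ 0)
    (h2 : ∀ f : Fin 2 → ι, Injective f → (N.submatrix f f).det = 0)
    (h3 : ∀ f : Fin 3 → ι, Injective f → (N.submatrix f f).det ≠ 0) :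
    IsScaledShift 2 N := by
  have hsq (i j : ι) (hij : i ≠ j) : N i i * N j j = N i j ^ 2 := by
    have h := h2 ![i, j] (by
      intro x y; fin_cases x <;> fin_cases y <;> simp [hij, hij.symm])
    rw [det_fin_two] at h
    simp only [submatrix_apply, Matrix.cons_val] at h
    rw [hN.apply i j] at h
    linear_combination h
  have hne (i j : ι) (hij : i ≠ j) : N i j ≠ 0 := fun h0 =>
    mul_ne_zero (h1 i) (h1 j) (by rw [hsq i j hij, h0]; ring)
  refine .of_relations (by norm_num) hN o (h1 o) (fun i hi => hne o i hi.symm)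
    (fun i hi => by rw [hsq o i hi.symm]; ring) fun i j hi hj hij => ?_
  have h := h3 ![o, i, j] (by
    intro x y
    fin_cases x <;> fin_cases y <;> simp [hij, hij.symm, hi, hi.symm, hj, hj.symm])
  rw [det_fin_three] at h
  simp only [submatrix_apply, Matrix.cons_val] at h
  rw [hN.apply o i, hN.apply o j, hN.apply i j] at h
  have hi' := hsq o i hi.symm
  have hj' := hsq o j hj.symm
  have hij' := hsq i j hij
  have hprod : (N o o * N i j - N o i * N o j) * (N o o * N i j + N o i * N o j) = 0 := by
    linear_combination -(N o o) ^ 2 * hij' + N o o * N j j * hi' + N o i ^ 2 * hj'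
  rcases mul_eq_zero.1 hprod with h0 | h0
  · refine absurd ?_ h
    refine mul_left_cancel₀ (h1 o) ?_
    have hij0 : N o o * N i j = N o i * N o j := by linear_combination h0
    linear_combination (N o o * N j j - N o j ^ 2) * hi' - (N o o * N i j - N o i * N o j) * hij0
  · linear_combination h0

lemma IsScaledShift.of_mul_eq_one {ι : Type*} [Fintype ι] [DecidableEq ι] {k : ℕ} (hk : k ≠ 0)
    (hι : Fintype.card ι = k + 2) {M N : Matrix ι ι ℝ} (hMN : M * N = 1)
    (hN : IsScaledShift 2 N) : IsScaledShift k M := by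
  obtain ⟨a, d, ha, hd, h⟩ := hN
  have hk' : (k : ℝ) ≠ 0 := Nat.cast_ne_zero.2 hk
  let L : Matrix ι ι ℝ := of fun i j =>
    (2 * k * a)⁻¹ * (d i)⁻¹ * (d j)⁻¹ * ((if i = j then (k : ℝ) else 0) - 1)
  have hNL : N * L = 1 := by
    ext i j
    have hterm (l : ι) : N i l * L l j = (2 * (k : ℝ))⁻¹ * d i * (d j)⁻¹ *
        (((if i = l then (2 : ℝ) else 0) - 1) * ((if l = j then (k : ℝ) else 0) - 1)) := by
      have := hd l
      rw [h]
      simp only [L, of_apply]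
      field_simp
    rw [mul_apply, sum_congr rfl fun l _ => hterm l, ← mul_sum]
    have hsum : ∑ l, (((if i = l then (2 : ℝ) else 0) - 1) * ((if l = j then (k : ℝ) else 0) - 1))
        = if i = j then 2 * (k : ℝ) else 0 := by
      simp only [sub_mul, mul_sub, sum_sub_distrib, ite_mul, zero_mul, one_mul, mul_one,
        sum_ite_eq, sum_ite_eq', mem_univ, if_true, sum_const, card_univ, hι, nsmul_eq_mul]
      split_ifs <;> push_cast <;> ring
    rw [hsum, one_apply]
    split_ifs with hij
    · subst hij
      have := hd i
      field_simp
    · simp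
  have hML : M = L := by
    rw [← Matrix.mul_one M, ← hNL, ← Matrix.mul_assoc, hMN, Matrix.one_mul]
  exact ⟨(2 * k * a)⁻¹, fun i => (d i)⁻¹, by positivity, fun i => inv_ne_zero (hd i),
    fun i j => by rw [hML]; rfl⟩

lemma det_scaledShift {ι : Type*} [Fintype ι] [DecidableEq ι] {c : ℝ} (hc : c ≠ 0) (a : ℝ)
    (d : ι → ℝ) :
    (of fun i j => a * d i * d j * ((if i = j then c else 0) - 1) : Matrix ι ι ℝ).det * c =
      a ^ Fintype.card ι * (∏ i, d i) ^ 2 * c ^ Fintype.card ι * (c - Fintype.card ι) := by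
  have h : (of fun i j => a * d i * d j * ((if i = j then c else 0) - 1) : Matrix ι ι ℝ) =
      (a * c) • (diagonal d *
        (1 + replicateCol Unit (fun _ : ι => -c⁻¹) * replicateRow Unit (fun _ => (1 : ℝ))) *
        diagonal d) := by
    ext i j
    rw [Matrix.smul_apply, mul_diagonal, diagonal_mul, Matrix.add_apply, one_apply]
    simp [mul_apply]
    split_ifs <;> field_simp <;> ring
  rw [h, det_smul, det_mul, det_mul, det_diagonal, det_one_add_replicateCol_mul_replicateRow]
  simp [dotProduct]
  field_simp
  ring

/-- The principal submatrices of order `k + 2` are scaled copies of `k • 1 - J`. -/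
lemma IsScaledShift.of_minors {k : ℕ} (hk : 2 ≤ k)
    {M : Matrix (Fin (k - 1) ⊕ Fin 3) (Fin (k - 1) ⊕ Fin 3) ℝ} (hM : M.IsSymm)
    (h1 : ∀ {m : Type} [Fintype m] [DecidableEq m] (f : m → Fin (k - 1) ⊕ Fin 3), Injective f →
      Fintype.card m = k - 1 → (M.submatrix f f).det ≠ 0)
    (h2 : ∀ {m : Type} [Fintype m] [DecidableEq m] (f : m → Fin (k - 1) ⊕ Fin 3), Injective f →
      Fintype.card m = k → (M.submatrix f f).det = 0)
    (h3 : ∀ {m : Type} [Fintype m] [DecidableEq m] (f : m → Fin (k - 1) ⊕ Fin 3), Injective f →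
      Fintype.card m = k + 1 → (M.submatrix f f).det ≠ 0) :
    IsScaledShift k M := by
  have hcard : Fintype.card (Fin (k - 1) ⊕ Fin 3) = k + 2 := by simp; omega
  have hdet : M.det ≠ 0 := by
    refine det_ne_zero_of_bordered M hM (h1 Sum.inl Sum.inl_injective (by simp)) (fun f => ?_)
      fun f hf => ?_
    · exact h2 _ (injective_id.sumMap (injective_of_subsingleton f)) (by simp; omega)
    · exact h3 _ (injective_id.sumMap hf) (by simp; omega)
  have hMN : M * M⁻¹ = 1 := mul_nonsing_inv M hdet.isUnit
  have hN : M⁻¹.IsSymm := by rw [Matrix.IsSymm, transpose_nonsing_inv, hM]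
  refine .of_mul_eq_one (by omega) hcard hMN (.of_minors_two hN (Sum.inr 0) (fun i h0 => ?_)
    (fun f hf => ?_) fun f hf h0 => ?_)
  · obtain ⟨s, hs, h⟩ := det_mul_det_submatrix_of_mul_eq_one M M⁻¹ hMN (fun _ : Fin 1 => i)
      (injective_of_subsingleton _)
    refine h3 _ Subtype.val_injective ?_ (h.symm.trans ?_)
    · rw [Fintype.card_coe]; rw [Fintype.card_fin, hcard] at hs; omega
    · simp [h0]
  · obtain ⟨s, hs, h⟩ := det_mul_det_submatrix_of_mul_eq_one M M⁻¹ hMN f hf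
    refine (mul_eq_zero.1 (h.trans (h2 _ Subtype.val_injective ?_))).resolve_left hdet
    rw [Fintype.card_coe]; rw [Fintype.card_fin, hcard] at hs; omega
  · obtain ⟨s, hs, h⟩ := det_mul_det_submatrix_of_mul_eq_one M M⁻¹ hMN f hf
    refine h1 _ Subtype.val_injective ?_ (h.symm.trans ?_)
    · rw [Fintype.card_coe]; rw [Fintype.card_fin, hcard] at hs; omega
    · rw [h0, mul_zero]

/-- A matrix is a scaled copy of `k • 1 - J` if its principal submatrices of order `k + 2` are. -/
lemma IsScaledShift.of_submatrix {n k : ℕ} (hk : 2 ≤ k) (hkn : k + 2 ≤ n)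
    {B : Matrix (Fin n) (Fin n) ℝ} (hB : B.IsSymm)
    (h : ∀ f : Fin (k - 1) ⊕ Fin 3 → Fin n, Injective f → IsScaledShift k (B.submatrix f f)) :
    IsScaledShift k B := by
  have hloc (s : Finset (Fin n)) (hs : s.card ≤ 3) : ∃ (a : ℝ) (d : Fin n → ℝ), a ≠ 0 ∧
      (∀ i ∈ s, d i ≠ 0) ∧ ∀ i ∈ s, ∀ j ∈ s,
        B i j = a * d i * d j * ((if i = j then (k : ℝ) else 0) - 1) := by
    obtain ⟨t, hst, ht⟩ := Finset.exists_superset_card_eq (s := s) (n := k + 2) (by omega)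
      (by simpa using hkn)
    have e : Fin (k - 1) ⊕ Fin 3 ≃ t := Fintype.equivOfCardEq (by simp [ht]; omega)
    have hf : Injective fun x => (e x : Fin n) := Subtype.val_injective.comp e.injective
    obtain ⟨a, d, ha, hd, hBd⟩ := h _ hf
    refine ⟨a, fun i => if hi : i ∈ t then d (e.symm ⟨i, hi⟩) else 0, ha, fun i hi => ?_,
      fun i hi j hj => ?_⟩
    · simpa [hst hi] using hd _
    · simpa [hst hi, hst hj] using hBd (e.symm ⟨i, hst hi⟩) (e.symm ⟨j, hst hj⟩)
  have hk1 : (k : ℝ) - 1 ≠ 0 := by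
    have : (2 : ℝ) ≤ k := by exact_mod_cast hk
    linarith
  refine .of_relations (sub_ne_zero.1 hk1) hB ⟨0, by omega⟩ ?_ (fun i hi => ?_) (fun i hi => ?_)
    fun i j hi hj hij => ?_
  · obtain ⟨a, d, ha, hd, hBd⟩ := hloc {⟨0, by omega⟩} (by simp)
    have := hd _ (mem_singleton_self _)
    rw [hBd _ (by simp) _ (by simp), if_pos rfl]
    positivity
  · obtain ⟨a, d, ha, hd, hBd⟩ := hloc {⟨0, by omega⟩, i} (card_le_two.trans (by norm_num))
    have h0 := hd ⟨0, by omega⟩ (by simp)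
    have h1 := hd i (by simp)
    rw [hBd _ (by simp) _ (by simp), if_neg hi.symm, zero_sub]
    exact mul_ne_zero (by positivity) (by norm_num)
  · obtain ⟨a, d, ha, hd, hBd⟩ := hloc {⟨0, by omega⟩, i} (card_le_two.trans (by norm_num))
    rw [hBd ⟨0, by omega⟩ (by simp) ⟨0, by omega⟩ (by simp), hBd i (by simp) i (by simp),
      hBd ⟨0, by omega⟩ (by simp) i (by simp), if_pos rfl, if_pos rfl, if_neg hi.symm]
    ring
  · obtain ⟨a, d, ha, hd, hBd⟩ := hloc {⟨0, by omega⟩, i, j} card_le_three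
    rw [hBd ⟨0, by omega⟩ (by simp) ⟨0, by omega⟩ (by simp), hBd i (by simp) j (by simp),
      hBd ⟨0, by omega⟩ (by simp) i (by simp), hBd ⟨0, by omega⟩ (by simp) j (by simp),
      if_pos rfl, if_neg hij, if_neg hi.symm, if_neg hj.symm]
    ring

/-- for a real symmetric matrix whose epr-sequence has ANA at positions
k−1, k, k+1 (non-terminal), every other term is A⁺ or A⁻, and the signs at positions k−1
and k+1 are opposite. -/
theorem ANA_lemma {n : ℕ} (B : Matrix (Fin n) (Fin n) ℝ) (hB : B.IsSymm)
    (k : ℕ) (hk1 : 2 ≤ k) (hk2 : k ≤ n - 2)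
    (h1 : ∀ α : Finset (Fin n), α.card = k - 1 → pminorR B α ≠ 0)
    (h2 : ∀ α : Finset (Fin n), α.card = k → pminorR B α = 0)
    (h3 : ∀ α : Finset (Fin n), α.card = k + 1 → pminorR B α ≠ 0) :
    ∃ δ : ℕ → ℝ,
      (∀ i : ℕ, 1 ≤ i → i ≤ n → i ≠ k →
        (δ i = 1 ∨ δ i = -1) ∧
        ∀ α : Finset (Fin n), α.card = i → 0 < δ i * pminorR B α) ∧
      δ (k + 1) = - δ (k - 1) := by
  have hS : IsScaledShift k B := .of_submatrix hk1 (by omega) hB fun f hf =>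
    .of_minors hk1 (hB.submatrix f)
      (fun g hg hc => by
        rw [submatrix_submatrix, det_submatrix_of_injective B (f ∘ g) (hf.comp hg)]
        exact h1 _ (by rw [card_map, card_univ, hc]))
      (fun g hg hc => by
        rw [submatrix_submatrix, det_submatrix_of_injective B (f ∘ g) (hf.comp hg)]
        exact h2 _ (by rw [card_map, card_univ, hc]))
      (fun g hg hc => by
        rw [submatrix_submatrix, det_submatrix_of_injective B (f ∘ g) (hf.comp hg)]
        exact h3 _ (by rw [card_map, card_univ, hc]))
  obtain ⟨a, d, ha, hd, hBd⟩ := hS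
  have hk0 : (0 : ℝ) < k := by exact_mod_cast (by omega : 0 < k)
  have hminor (α : Finset (Fin n)) : pminorR B α * k = a ^ α.card * (∏ i : α, d i) ^ 2 *
      k ^ α.card * (k - α.card) := by
    have h := det_scaledShift (ι := α) hk0.ne' a (fun i => d i)
    rw [Fintype.card_coe] at h
    rw [← h]
    congr 1
    refine congrArg det (Matrix.ext fun i j => ?_)
    rw [hBd, of_apply]
    simp only [Subtype.ext_iff]
  refine ⟨fun i => Real.sign (a ^ i * ((k : ℝ) - i)), fun i _ _ hik => ?_, ?_⟩
  · have hne : a ^ i * ((k : ℝ) - i) ≠ 0 :=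
      mul_ne_zero (pow_ne_zero _ ha) (sub_ne_zero.2 (by exact_mod_cast hik.symm))
    refine ⟨(Real.sign_apply_eq_of_ne_zero _ hne).symm, fun α hα => ?_⟩
    have hprod : (∏ j : α, d j) ≠ 0 := prod_ne_zero_iff.2 fun j _ => hd j
    have hpos : 0 < Real.sign (a ^ i * ((k : ℝ) - i)) * (a ^ i * ((k : ℝ) - i)) :=
      Real.sign_mul_pos_of_ne_zero _ hne
    refine pos_of_mul_pos_left (b := (k : ℝ)) ?_ hk0.le
    rw [mul_assoc, hminor, hα]
    have : 0 < (∏ j : α, d j) ^ 2 * (k : ℝ) ^ i := by positivity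
    calc 0 < _ := mul_pos hpos this
      _ = _ := by ring
  · have h : a ^ (k + 1) = a ^ (k - 1) * a ^ 2 := by rw [← pow_add]; congr 1; omega
    have hcast : ((k - 1 : ℕ) : ℝ) = k - 1 := by push_cast [show 1 ≤ k by omega]; ring
    dsimp only
    rw [hcast, h]
    push_cast
    rcases lt_or_gt_of_ne (pow_ne_zero (k - 1) ha) with h' | h'
    · rw [Real.sign_of_pos, Real.sign_of_neg, neg_neg]
      · linarith
      · have := mul_pos (neg_pos.2 h') (sq_pos_of_ne_zero ha)
        linarith
    · rw [Real.sign_of_neg, Real.sign_of_pos]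
      · linarith
      · have := mul_pos h' (sq_pos_of_ne_zero ha)
        linarith
end
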